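/- Let Y_{ab} be a Yano tensor of rank two on U, let X^m be a smooth vector field with ∇_cY_{ab} = ε_{abcm}X^m, and suppose X is a Killing vector field of g. Then the Lie derivative of Y along X is covariantly constant: ∇_a(£_XY)_{bc} = 0 on U. -/

import Mathlib

/-!
STATEMENT 8: If `Y` is a Yano tensor with `∇_cY_{ab} = ε_{abcm}X^m` and `X`
is a Killing vector field of `g`, then `£_XY` is covariantly constant:
`∇_a(£_XY)_{bc} = 0` on `U`.
-/

noncomputable section

abbrev Pt : Type := Fin 4 → ℝ

/-- Partial derivative of a scalar field in the `c`-th coordinate direction. -/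
def pd (f : Pt → ℝ) (c : Fin 4) (p : Pt) : ℝ := fderiv ℝ f p (Pi.single c 1)

/-- Covariant derivative `∇_c X_a` of a covector field. -/
def covVec (Γ : Fin 4 → Fin 4 → Fin 4 → Pt → ℝ) (X : Fin 4 → Pt → ℝ)
    (c a : Fin 4) (p : Pt) : ℝ :=
  pd (X a) c p - ∑ m, Γ m c a p * X m p

/-- Covariant derivative `∇_c Y_{ab}` of a (0,2)-tensor field. -/
def cov2 (Γ : Fin 4 → Fin 4 → Fin 4 → Pt → ℝ) (Y : Fin 4 → Fin 4 → Pt → ℝ)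
    (c a b : Fin 4) (p : Pt) : ℝ :=
  pd (Y a b) c p - ∑ m, Γ m c a p * Y m b p - ∑ m, Γ m c b p * Y a m p

/-- Sign of `(a,b,c,d)` as a permutation of `(0,1,2,3)`; `0` if indices repeat. -/
def sgn4 (a b c d : Fin 4) : ℝ :=
  let v : Fin 4 → ℝ := ![(a.1 : ℝ), (b.1 : ℝ), (c.1 : ℝ), (d.1 : ℝ)]
  ∏ i : Fin 4, ∏ j : Fin 4, if i < j then (v j - v i) / ((j.1 : ℝ) - (i.1 : ℝ)) else 1

/-- The volume tensor `ε_{abcd} = √(−det g)·sgn(abcd)`. -/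
def eps (g : Fin 4 → Fin 4 → Pt → ℝ) (a b c d : Fin 4) (p : Pt) : ℝ :=
  Real.sqrt (-(Matrix.det (Matrix.of fun i j => g i j p))) * sgn4 a b c d

/-- Lie derivative of a (0,2)-tensor field along the vector field `X`. -/
def lie2 (X : Fin 4 → Pt → ℝ) (T : Fin 4 → Fin 4 → Pt → ℝ)
    (a b : Fin 4) (p : Pt) : ℝ :=
  (∑ c, X c p * pd (T a b) c p) + (∑ c, T c b p * pd (X c) a p)
    + (∑ c, T a c p * pd (X c) b p)

/-! ### Determinants -/

section Determinant

variable {n : Type*} [Fintype n] [DecidableEq n]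

theorem Matrix.sum_det_updateRow {R : Type*} [CommRing R] (A B : Matrix n n R) :
    ∑ i, (A.updateRow i (B i)).det = (A.adjugate * B).trace := by
  rw [Matrix.trace_mul_comm]
  refine Finset.sum_congr rfl fun i _ => ?_
  rw [← Matrix.cramer_transpose_apply, Matrix.cramer_eq_adjugate_mulVec,
    ← Matrix.adjugate_transpose, Matrix.mulVec_transpose]
  rfl

theorem Matrix.hasFDerivAt_det {E : Type*} [NormedAddCommGroup E] [NormedSpace ℝ E]
    {A : E → Matrix n n ℝ} {A' : n → n → E →L[ℝ] ℝ} {x : E}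
    (hA : ∀ i j, HasFDerivAt (fun y => A y i j) (A' i j) x) :
    ∃ L : E →L[ℝ] ℝ, HasFDerivAt (fun y => (A y).det) L x ∧
      ∀ v, L v = ((A x).adjugate * Matrix.of fun i j => A' i j v).trace := by
  let D : ContinuousMultilinearMap ℝ (fun _ : n => n → ℝ) ℝ :=
    { (Matrix.detRowAlternating : (n → ℝ) [⋀^n]→ₗ[ℝ] ℝ).toMultilinearMap with
      cont := Continuous.matrix_det (A := fun M : n → n → ℝ => Matrix.of M) continuous_id }
  have hrows : HasFDerivAt (fun y i j => A y i j)
      (ContinuousLinearMap.pi fun i => ContinuousLinearMap.pi fun j => A' i j) x :=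
    hasFDerivAt_pi.2 fun i => hasFDerivAt_pi.2 fun j => hA i j
  refine ⟨_, HasFDerivAt.comp (g := D) (f := fun y i j => A y i j) x (D.hasFDerivAt _) hrows,
    fun v => ?_⟩
  rw [← Matrix.sum_det_updateRow, ContinuousLinearMap.comp_apply,
    ContinuousMultilinearMap.linearDeriv_apply]
  rfl

end Determinant

theorem sgn4_eq_det (a b c d : Fin 4) :
    sgn4 a b c d = ((1 : Matrix (Fin 4) (Fin 4) ℝ).submatrix (![a, b, c, d] : Fin 4 → Fin 4) id).det := by
  have hprod (v : Fin 4 → ℝ) : (Matrix.vandermonde v).det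
      = (v 1 - v 0) * (v 2 - v 0) * (v 3 - v 0) * ((v 2 - v 1) * (v 3 - v 1)) * (v 3 - v 2) := by
    rw [Matrix.det_vandermonde, Fin.prod_univ_four,
      show Finset.Ioi (0 : Fin 4) = {1, 2, 3} by decide, show Finset.Ioi (1 : Fin 4) = {2, 3} by decide,
      show Finset.Ioi (2 : Fin 4) = {3} by decide, show Finset.Ioi (3 : Fin 4) = ∅ by decide]
    simp [mul_assoc]
  have hmul (f : Fin 4 → Fin 4) : Matrix.vandermonde (fun i => ((f i).1 : ℝ))
      = (1 : Matrix (Fin 4) (Fin 4) ℝ).submatrix f id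
        * Matrix.vandermonde fun i : Fin 4 => (i.1 : ℝ) := by
    ext i j
    simp [Matrix.mul_apply, Matrix.one_apply, Matrix.vandermonde_apply]
  have hdet := congrArg Matrix.det (hmul ![a, b, c, d])
  rw [Matrix.det_mul, hprod, hprod] at hdet
  generalize ((1 : Matrix (Fin 4) (Fin 4) ℝ).submatrix _ id).det = δ at hdet ⊢
  change ((b.1 : ℝ) - a.1) * (c.1 - a.1) * (d.1 - a.1) * ((c.1 - b.1) * (d.1 - b.1)) * (d.1 - c.1)
    = δ * _ at hdet
  norm_num at hdet
  simp only [sgn4, Fin.prod_univ_four]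
  simp
  linear_combination hdet / 12

/-- Infinitesimal invariance of the permutation sign under a linear map, up to its trace. -/
theorem sum_sgn4_mul (K : Fin 4 → Fin 4 → ℝ) (a b c d : Fin 4) :
    ∑ n, K a n * sgn4 n b c d + ∑ n, K b n * sgn4 a n c d + ∑ n, K c n * sgn4 a b n d
      + ∑ n, K d n * sgn4 a b c n = (∑ n, K n n) * sgn4 a b c d := by
  set R := (1 : Matrix (Fin 4) (Fin 4) ℝ).submatrix (![a, b, c, d] : Fin 4 → Fin 4) id with hR
  have key := Matrix.sum_det_updateRow R (R * Matrix.of K)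
  rw [← Matrix.mul_assoc, Matrix.adjugate_mul, Matrix.smul_mul, Matrix.one_mul,
    Matrix.trace_smul, hR, ← sgn4_eq_det, Fin.sum_univ_four,
    show (Matrix.of K).trace = ∑ n, K n n from rfl] at key
  have hrow (f : Fin 4 → Fin 4) (i : Fin 4) :
      (((1 : Matrix (Fin 4) (Fin 4) ℝ).submatrix f id).updateRow i
        (((1 : Matrix (Fin 4) (Fin 4) ℝ).submatrix f id * Matrix.of K) i)).det
      = ∑ n, K (f i) n
        * ((1 : Matrix (Fin 4) (Fin 4) ℝ).submatrix (Function.update f i n) id).det := by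
    have hsum : ((1 : Matrix (Fin 4) (Fin 4) ℝ).submatrix f id * Matrix.of K) i
        = ∑ n, K (f i) n • (1 : Matrix (Fin 4) (Fin 4) ℝ) n := by
      ext j
      simp [Matrix.mul_apply, Matrix.one_apply]
    have hupd (n : Fin 4) : (1 : Matrix (Fin 4) (Fin 4) ℝ).submatrix (Function.update f i n) id
        = ((1 : Matrix (Fin 4) (Fin 4) ℝ).submatrix f id).updateRow i
          ((1 : Matrix (Fin 4) (Fin 4) ℝ) n) := by
      ext k j
      by_cases hk : k = i
      · subst hk; simp [Matrix.submatrix_apply, Matrix.one_apply]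
      · simp [Matrix.submatrix_apply, Matrix.one_apply, hk]
    simp only [hsum, hupd, ← Matrix.cramer_transpose_apply, map_sum, map_smul, Finset.sum_apply,
      Pi.smul_apply, smul_eq_mul]
  simp only [hrow, Fin.sum_univ_four, sgn4_eq_det] at key ⊢
  have u0 n : Function.update ![a, b, c, d] 0 n = ![n, b, c, d] := by
    ext i; fin_cases i <;> rfl
  have u1 n : Function.update ![a, b, c, d] 1 n = ![a, n, c, d] := by
    ext i; fin_cases i <;> rfl
  have u2 n : Function.update ![a, b, c, d] 2 n = ![a, b, n, d] := by
    ext i; fin_cases i <;> rfl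
  have u3 n : Function.update ![a, b, c, d] 3 n = ![a, b, c, n] := by
    ext i; fin_cases i <;> rfl
  simp only [u0, u1, u2, u3] at key
  refine key.trans ?_
  rw [smul_eq_mul]
  ring

/-! ### Coordinate derivatives -/

theorem ContDiffAt.pd {f : Pt → ℝ} {p : Pt} (hf : ContDiffAt ℝ 2 f p) (c : Fin 4) :
    DifferentiableAt ℝ (pd f c) p :=
  ((hf.fderiv_right (m := 1) (by norm_num)).differentiableAt (by norm_num)).clm_apply
    (differentiableAt_const _)

theorem pd_comm {f : Pt → ℝ} {p : Pt} (hf : ContDiffAt ℝ 2 f p) (a b : Fin 4) :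
    pd (pd f a) b p = pd (pd f b) a p := by
  have hd : DifferentiableAt ℝ (fderiv ℝ f) p :=
    (hf.fderiv_right (m := 1) (by norm_num)).differentiableAt (by norm_num)
  have h (a b : Fin 4) : pd (pd f a) b p
      = fderiv ℝ (fderiv ℝ f) p (Pi.single b 1) (Pi.single a 1) := by
    change fderiv ℝ (fun q => fderiv ℝ f q (Pi.single a 1)) p _ = _
    rw [fderiv_clm_apply hd (differentiableAt_const _)]
    simp
  rw [h, h]
  exact hf.isSymmSndFDerivAt (by simp) _ _

theorem pd_add {f h : Pt → ℝ} {p : Pt} (hf : DifferentiableAt ℝ f p)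
    (hh : DifferentiableAt ℝ h p) (c : Fin 4) :
    pd (fun q => f q + h q) c p = pd f c p + pd h c p := by
  simp [pd, fderiv_fun_add hf hh]

theorem pd_sub {f h : Pt → ℝ} {p : Pt} (hf : DifferentiableAt ℝ f p)
    (hh : DifferentiableAt ℝ h p) (c : Fin 4) :
    pd (fun q => f q - h q) c p = pd f c p - pd h c p := by
  simp [pd, fderiv_fun_sub hf hh]

theorem pd_mul {f h : Pt → ℝ} {p : Pt} (hf : DifferentiableAt ℝ f p)
    (hh : DifferentiableAt ℝ h p) (c : Fin 4) :
    pd (fun q => f q * h q) c p = pd f c p * h p + f p * pd h c p := by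
  simp [pd, fderiv_fun_mul hf hh]; ring

theorem pd_sum_mul {f h : Fin 4 → Pt → ℝ} {p : Pt} (hf : ∀ m, DifferentiableAt ℝ (f m) p)
    (hh : ∀ m, DifferentiableAt ℝ (h m) p) (c : Fin 4) :
    pd (fun q => ∑ m, f m q * h m q) c p
      = ∑ m, (pd (f m) c p * h m p + f m p * pd (h m) c p) := by
  simp only [← fun m => pd_mul (hf m) (hh m) c]
  simp only [pd]
  rw [fderiv_fun_sum fun m _ => (hf m).fun_mul (hh m)]
  simp

theorem fderiv_apply_eq_sum_pd (f : Pt → ℝ) (p v : Pt) :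
    fderiv ℝ f p v = ∑ n, v n * pd f n p := by
  conv_lhs => rw [← Finset.univ_sum_single v]
  rw [map_sum]
  refine Finset.sum_congr rfl fun n _ => ?_
  rw [pd, ← smul_eq_mul, ← map_smul, ← Pi.single_smul, smul_eq_mul, mul_one]

theorem pd_congr {f h : Pt → ℝ} {p : Pt} (hfh : f =ᶠ[nhds p] h) (c : Fin 4) :
    pd f c p = pd h c p := by
  rw [pd, pd, hfh.fderiv_eq]

/-! ### Lie derivatives -/

/-- Lie derivative of a (0,3)-tensor field along the vector field `X`. -/
def lie3 (X : Fin 4 → Pt → ℝ) (S : Fin 4 → Fin 4 → Fin 4 → Pt → ℝ)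
    (c a b : Fin 4) (p : Pt) : ℝ :=
  (∑ n, X n p * pd (S c a b) n p) + (∑ n, S n a b p * pd (X n) c p)
    + (∑ n, S c n b p * pd (X n) a p) + (∑ n, S c a n p * pd (X n) b p)

/-- Lie derivative of the connection coefficients `Γ^m_{ab}` along the vector field `X`. -/
def lieConn (X : Fin 4 → Pt → ℝ) (Γ : Fin 4 → Fin 4 → Fin 4 → Pt → ℝ)
    (m a b : Fin 4) (p : Pt) : ℝ :=
  pd (pd (X m) b) a p + (∑ n, X n p * pd (Γ m a b) n p) + (∑ n, Γ m n b p * pd (X n) a p)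
    + (∑ n, Γ m a n p * pd (X n) b p) - ∑ n, Γ n a b p * pd (X m) n p

section Commutator

variable {Γ : Fin 4 → Fin 4 → Fin 4 → Pt → ℝ} {X : Fin 4 → Pt → ℝ}
  {T : Fin 4 → Fin 4 → Pt → ℝ} {p : Pt}

theorem pd_cov2 (hΓ : ∀ m a b, ContDiffAt ℝ 2 (Γ m a b) p) (hT : ∀ a b, ContDiffAt ℝ 2 (T a b) p)
    (n c a b : Fin 4) :
    pd (cov2 Γ T c a b) n p = pd (pd (T a b) c) n p
      - ∑ m, (pd (Γ m c a) n p * T m b p + Γ m c a p * pd (T m b) n p)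
      - ∑ m, (pd (Γ m c b) n p * T a m p + Γ m c b p * pd (T a m) n p) := by
  have dΓ m a b := (hΓ m a b).differentiableAt (by norm_num)
  have dT a b := (hT a b).differentiableAt (by norm_num)
  have d1 := (hT a b).pd c
  have d2 : DifferentiableAt ℝ (fun q => ∑ m, Γ m c a q * T m b q) p :=
    DifferentiableAt.fun_sum fun m _ => (dΓ m c a).mul (dT m b)
  have d3 : DifferentiableAt ℝ (fun q => ∑ m, Γ m c b q * T a m q) p :=
    DifferentiableAt.fun_sum fun m _ => (dΓ m c b).mul (dT a m)
  rw [← pd_sum_mul (fun m => dΓ m c a) (fun m => dT m b),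
    ← pd_sum_mul (fun m => dΓ m c b) (fun m => dT a m), ← pd_sub d1 d2, ← pd_sub (d1.fun_sub d2) d3]
  rfl

theorem pd_lie2 (hX : ∀ a, ContDiffAt ℝ 2 (X a) p) (hT : ∀ a b, ContDiffAt ℝ 2 (T a b) p)
    (n a b : Fin 4) :
    pd (lie2 X T a b) n p
      = ∑ m, (pd (X m) n p * pd (T a b) m p + X m p * pd (pd (T a b) m) n p)
      + ∑ m, (pd (T m b) n p * pd (X m) a p + T m b p * pd (pd (X m) a) n p)
      + ∑ m, (pd (T a m) n p * pd (X m) b p + T a m p * pd (pd (X m) b) n p) := by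
  have dX a := (hX a).differentiableAt (by norm_num)
  have dT a b := (hT a b).differentiableAt (by norm_num)
  have d1 : DifferentiableAt ℝ (fun q => ∑ m, X m q * pd (T a b) m q) p :=
    DifferentiableAt.fun_sum fun m _ => (dX m).mul ((hT a b).pd m)
  have d2 : DifferentiableAt ℝ (fun q => ∑ m, T m b q * pd (X m) a q) p :=
    DifferentiableAt.fun_sum fun m _ => (dT m b).mul ((hX m).pd a)
  have d3 : DifferentiableAt ℝ (fun q => ∑ m, T a m q * pd (X m) b q) p :=
    DifferentiableAt.fun_sum fun m _ => (dT a m).mul ((hX m).pd b)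
  rw [← pd_sum_mul dX fun m => (hT a b).pd m,
    ← pd_sum_mul (fun m => dT m b) fun m => (hX m).pd a,
    ← pd_sum_mul (fun m => dT a m) fun m => (hX m).pd b, ← pd_add d1 d2, ← pd_add (d1.fun_add d2) d3]
  rfl

/-- The commutator of the Lie derivative and the covariant derivative on (0,2)-tensors. -/
theorem cov2_lie2 (hΓ : ∀ m a b, ContDiffAt ℝ 2 (Γ m a b) p) (hX : ∀ a, ContDiffAt ℝ 2 (X a) p)
    (hT : ∀ a b, ContDiffAt ℝ 2 (T a b) p) (c a b : Fin 4) :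
    cov2 Γ (lie2 X T) c a b p = lie3 X (cov2 Γ T) c a b p
      + ∑ m, lieConn X Γ m c a p * T m b p + ∑ m, lieConn X Γ m c b p * T a m p := by
  simp only [lie3, pd_cov2 hΓ hT]
  simp only [cov2, pd_lie2 hX hT, fun m => pd_comm (hT a b) m c]
  simp only [lie2, lieConn, Fin.sum_univ_four]
  ring

end Commutator

/-- A Killing field whose connection is metric and torsion-free preserves the connection. -/
theorem lieConn_eq_zero_of_killing {Γ : Fin 4 → Fin 4 → Fin 4 → Pt → ℝ} {X : Fin 4 → Pt → ℝ}
    {g : Fin 4 → Fin 4 → Pt → ℝ} {p : Pt} (hΓ : ∀ m a b, ContDiffAt ℝ 2 (Γ m a b) p)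
    (hX : ∀ a, ContDiffAt ℝ 2 (X a) p) (hg : ∀ a b, ContDiffAt ℝ 2 (g a b) p)
    (hΓsymm : ∀ m a b, Γ m a b =ᶠ[nhds p] Γ m b a)
    (hgsymm : ∀ a b, g a b p = g b a p) {ginv : Fin 4 → Fin 4 → ℝ}
    (hginv : ∀ a b, (∑ m, g a m p * ginv m b) = if a = b then 1 else 0)
    (hcompat : ∀ c a b, cov2 Γ g c a b =ᶠ[nhds p] 0)
    (hKilling : ∀ a b, lie2 X g a b =ᶠ[nhds p] 0) (m a b : Fin 4) :
    lieConn X Γ m a b p = 0 := by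
  have pd_zero (f : Pt → ℝ) (hf : f =ᶠ[nhds p] 0) (n : Fin 4) : pd f n p = 0 := by
    rw [pd_congr hf]; simp [pd]
  have hsymm (m a b : Fin 4) : lieConn X Γ m a b p = lieConn X Γ m b a p := by
    simp only [lieConn, pd_comm (hX m) a b, fun n => pd_congr (hΓsymm m a b) n,
      fun n => (hΓsymm n a b).eq_of_nhds, fun n => (hΓsymm m n b).eq_of_nhds,
      fun n => (hΓsymm m a n).eq_of_nhds]
    ring
  set B : Fin 4 → Fin 4 → Fin 4 → ℝ := fun c a b => ∑ m, lieConn X Γ m c a p * g m b p with hB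
  have hBsymm (c a b : Fin 4) : B c a b = B a c b := by simp only [hB, fun m => hsymm m c a]
  have hBanti (c a b : Fin 4) : B c a b + B c b a = 0 := by
    have h := cov2_lie2 hΓ hX hg c a b
    have h0 : cov2 Γ (lie2 X g) c a b p = 0 := by
      simp [cov2, pd_zero _ (hKilling _ _), fun a b => (hKilling a b).eq_of_nhds]
    have h1 : lie3 X (cov2 Γ g) c a b p = 0 := by
      simp [lie3, pd_zero _ (hcompat _ _ _), fun c a b => (hcompat c a b).eq_of_nhds]
    rw [h0, h1, zero_add] at h
    simp only [hB, h, hgsymm _ a]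
  have hB0 (c a b : Fin 4) : B c a b = 0 := by
    linarith [hBanti c a b, hBanti b c a, hBanti a b c, hBsymm c b a, hBsymm b a c, hBsymm a c b]
  have : ∑ k, B a b k * ginv k m = lieConn X Γ m a b p := by
    simp only [hB, Finset.sum_mul]
    rw [Finset.sum_comm]
    simp [mul_assoc, ← Finset.mul_sum, hginv]
  rw [← this]
  simp [hB0]

/-- A Killing field preserves the volume density. -/
theorem sum_mul_pd_sqrt_det {X : Fin 4 → Pt → ℝ} {g : Fin 4 → Fin 4 → Pt → ℝ} {p : Pt}
    (hg : ∀ a b, DifferentiableAt ℝ (g a b) p)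
    (hgdet : Matrix.det (Matrix.of fun i j => g i j p) < 0)
    (hKilling : ∀ a b, lie2 X g a b p = 0) :
    DifferentiableAt ℝ (fun q => Real.sqrt (-(Matrix.det (Matrix.of fun i j => g i j q)))) p ∧
    ∑ n, X n p * pd (fun q => Real.sqrt (-(Matrix.det (Matrix.of fun i j => g i j q)))) n p
      = -(Real.sqrt (-(Matrix.det (Matrix.of fun i j => g i j p))) * ∑ n, pd (X n) n p) := by
  obtain ⟨L, hL, hLv⟩ := Matrix.hasFDerivAt_det
    (A := fun q => Matrix.of fun i j => g i j q) fun i j => (hg i j).hasFDerivAt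
  have hs := hL.neg.sqrt (by simpa using hgdet.ne)
  refine ⟨hs.differentiableAt, ?_⟩
  set D := Matrix.det (Matrix.of fun i j => g i j p)
  set K : Matrix (Fin 4) (Fin 4) ℝ := Matrix.of fun a c => pd (X c) a p with hK
  set G : Matrix (Fin 4) (Fin 4) ℝ := Matrix.of fun i j => g i j p with hG
  have hXL : L (fun n => X n p) = -(2 * D * ∑ n, pd (X n) n p) := by
    have hdG : (Matrix.of fun i j => fderiv ℝ (g i j) p fun n => X n p) = -(K * G + G * K.transpose) := by
      ext i j
      have h := hKilling i j
      simp only [lie2] at h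
      simp only [Matrix.of_apply, Matrix.neg_apply, Matrix.add_apply, Matrix.mul_apply,
        Matrix.transpose_apply, fderiv_apply_eq_sum_pd, hK, hG, mul_comm (pd _ i p)]
      linarith
    rw [hLv, hdG, Matrix.mul_neg, Matrix.trace_neg, Matrix.mul_add, Matrix.trace_add,
      ← Matrix.mul_assoc, ← Matrix.mul_assoc, Matrix.trace_mul_comm, ← Matrix.mul_assoc,
      Matrix.mul_adjugate, Matrix.adjugate_mul]
    simp only [Matrix.smul_mul, Matrix.one_mul, Matrix.trace_smul, Matrix.trace_transpose,
      smul_eq_mul]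
    change -(D * ∑ n, pd (X n) n p + D * ∑ n, pd (X n) n p) = _
    ring
  have hsum : ∑ n, X n p * pd (fun q => Real.sqrt (-(Matrix.det (Matrix.of fun i j => g i j q)))) n p
      = 1 / (2 * Real.sqrt (-D)) * -(L (fun n => X n p)) := by
    rw [← fderiv_apply_eq_sum_pd _ p fun n => X n p]
    exact congrArg (fun M : Pt →L[ℝ] ℝ => M fun n => X n p) hs.fderiv
  rw [hsum, hXL]
  have hpos : 0 < Real.sqrt (-D) := Real.sqrt_pos.2 (by linarith)
  have hsq : Real.sqrt (-D) ^ 2 = -D := Real.sq_sqrt (by linarith)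
  field_simp
  rw [hsq]
  ring

/-- A Killing field `X` preserves the 3-form obtained by contracting it with the volume form. -/
theorem lie3_eps_contract {X : Fin 4 → Pt → ℝ} {g : Fin 4 → Fin 4 → Pt → ℝ} {p : Pt}
    (hX : ∀ a, DifferentiableAt ℝ (X a) p) (hg : ∀ a b, DifferentiableAt ℝ (g a b) p)
    (hgdet : Matrix.det (Matrix.of fun i j => g i j p) < 0)
    (hKilling : ∀ a b, lie2 X g a b p = 0) (c a b : Fin 4) :
    lie3 X (fun c a b q => ∑ m, eps g a b c m q * X m q) c a b p = 0 := by
  obtain ⟨hd, hs⟩ := sum_mul_pd_sqrt_det hg hgdet hKilling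
  have hpd (n : Fin 4) : pd (fun q => ∑ m, eps g a b c m q * X m q) n p = ∑ m,
      (pd (fun q => Real.sqrt (-(Matrix.det (Matrix.of fun i j => g i j q)))) n p * sgn4 a b c m
        * X m p + eps g a b c m p * pd (X m) n p) := by
    have heps m : pd (eps g a b c m) n p = pd (fun q =>
        Real.sqrt (-(Matrix.det (Matrix.of fun i j => g i j q)))) n p * sgn4 a b c m := by
      have h := pd_mul hd (differentiableAt_const (sgn4 a b c m)) n
      rw [show pd (fun _ => sgn4 a b c m) n p = 0 by simp [pd], mul_zero, add_zero] at h
      exact h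
    rw [pd_sum_mul (f := eps g a b c) (fun m => hd.mul_const _) hX]
    simp only [heps]
  have hsgn m := sum_sgn4_mul (fun i n => pd (X n) i p) a b c m
  simp only [lie3, hpd]
  simp only [eps]
  set s := Real.sqrt (-(Matrix.det (Matrix.of fun i j => g i j p)))
  simp only [Fin.sum_univ_four] at hs hsgn ⊢
  linear_combination (sgn4 a b c 0 * X 0 p + sgn4 a b c 1 * X 1 p + sgn4 a b c 2 * X 2 p
    + sgn4 a b c 3 * X 3 p) * hs + s * X 0 p * hsgn 0 + s * X 1 p * hsgn 1 + s * X 2 p * hsgn 2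
    + s * X 3 p * hsgn 3

theorem lie_derivative_of_yano_covariantly_constant
    (U : Set Pt) (hU : IsOpen U)
    (Γ : Fin 4 → Fin 4 → Fin 4 → Pt → ℝ)
    (hΓsmooth : ∀ m a b, ContDiffOn ℝ (⊤ : ℕ∞) (Γ m a b) U)
    (hΓsymm : ∀ m a b, ∀ p ∈ U, Γ m a b p = Γ m b a p)
    (g ginv : Fin 4 → Fin 4 → Pt → ℝ)
    (hgsmooth : ∀ a b, ContDiffOn ℝ (⊤ : ℕ∞) (g a b) U)
    (hgsymm : ∀ a b, ∀ p ∈ U, g a b p = g b a p)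
    (hgdet : ∀ p ∈ U, Matrix.det (Matrix.of fun i j => g i j p) < 0)
    (hginv : ∀ p ∈ U, ∀ a b, (∑ m, g a m p * ginv m b p) = if a = b then 1 else 0)
    (hcompat : ∀ p ∈ U, ∀ c a b, cov2 Γ g c a b p = 0)
    (Y : Fin 4 → Fin 4 → Pt → ℝ)
    (hYsmooth : ∀ a b, ContDiffOn ℝ (⊤ : ℕ∞) (Y a b) U)
    (hYanti : ∀ a b, ∀ p ∈ U, Y a b p = - Y b a p)
    (hYano : ∀ a b c, ∀ p ∈ U, cov2 Γ Y c b a p + cov2 Γ Y b c a p = 0)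
    (X : Fin 4 → Pt → ℝ)
    (hXsmooth : ∀ a, ContDiffOn ℝ (⊤ : ℕ∞) (X a) U)
    (hYX : ∀ p ∈ U, ∀ a b c, cov2 Γ Y c a b p = ∑ m, eps g a b c m p * X m p)
    (hKilling : ∀ p ∈ U, ∀ a b, lie2 X g a b p = 0) :
    ∀ p ∈ U, ∀ a b c, cov2 Γ (lie2 X Y) a b c p = 0 := by
  intro p hp c a b
  have hU' : U ∈ nhds p := hU.mem_nhds hp
  have ev {f h : Pt → ℝ} (H : ∀ q ∈ U, f q = h q) : f =ᶠ[nhds p] h :=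
    Filter.eventually_of_mem hU' H
  have smooth {f : Pt → ℝ} (hf : ContDiffOn ℝ (⊤ : ℕ∞) f U) : ContDiffAt ℝ 2 f p :=
    (hf.contDiffAt hU').of_le (WithTop.coe_le_coe.2 (le_top : (2 : ℕ∞) ≤ ⊤))
  have hX a := smooth (hXsmooth a)
  have hg a b := smooth (hgsmooth a b)
  have hΓ m a b := smooth (hΓsmooth m a b)
  have hA := lieConn_eq_zero_of_killing hΓ hX hg (fun m a b => ev (hΓsymm m a b))
    (fun a b => hgsymm a b p hp) (hginv p hp) (fun c a b => ev fun q hq => hcompat q hq c a b)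
    (fun a b => ev fun q hq => hKilling q hq a b)
  rw [cov2_lie2 hΓ hX fun a b => smooth (hYsmooth a b)]
  simp only [hA, zero_mul, Finset.sum_const_zero, add_zero]
  rw [← lie3_eps_contract (fun a => (hX a).differentiableAt (by norm_num))
    (fun a b => (hg a b).differentiableAt (by norm_num)) (hgdet p hp) (hKilling p hp) c a b]
  simp only [lie3, hYX p hp, fun c a b => pd_congr (ev fun q hq => hYX q hq a b c)]
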